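/- (Excess theorem for spherical 2-designs.) Let X be a spherical 2-design of size n in √m S^{m-1} which is an s-distance set with degree S = s. Then tr(F_s) = (1/n)∑_{x∈X} m_s(x) ≤ q_s(m), where m_s(x) = n(F_s)_{x,x} is the excess of x, F_s is the projection onto Harm_s(X), and q_s is the degree-s predegree polynomial. Moreover, equality holds if and only if X carries the structure of a Q-polynomial association scheme with respect to the idempotents {F_i}_{i=0}^s. -/

import Mathlib

open scoped InnerProductSpace Classical

noncomputable section

variable {V : Type*} [NormedAddCommGroup V] [InnerProductSpace ℝ V]

/-- `X` lies on the sphere of squared radius `m` (radius `√m`). -/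
def onSphere (m : ℝ) (X : Finset V) : Prop := ∀ x ∈ X, ⟪x, x⟫_ℝ = m

/-- The normalized Gram matrix `G` of `X`. -/
def gram (X : Finset V) : Matrix X X ℝ :=
  Matrix.of fun x y => (1 / (X.card : ℝ)) * ⟪(x : V), (y : V)⟫_ℝ

/-- The two conditions characterizing spherical 2-designs: `GJ = 0` and `G² = G`. -/
def IsTwoDesign (X : Finset V) : Prop :=
  (∀ x ∈ X, ∑ y ∈ X, ⟪x, y⟫_ℝ = 0) ∧
  (∀ x ∈ X, ∀ y ∈ X, (1 / (X.card : ℝ)) * ∑ z ∈ X, ⟪x, z⟫_ℝ * ⟪z, y⟫_ℝ = ⟪x, y⟫_ℝ)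

/-- `Pol_k(X)`: span of the zonal polynomials of degree at most `k`. -/
def Pol (X : Finset V) (k : ℕ) : Submodule ℝ (X → ℝ) :=
  Submodule.span ℝ {f | ∃ a ∈ X, ∃ p : Polynomial ℝ,
    p.natDegree ≤ k ∧ f = fun x => p.eval ⟪a, x.1⟫_ℝ}

/-- The inner product `(f,g) = (1/n) ∑ f(x) g(x)` on `C(X)`. -/
def inn (X : Finset V) (f g : X → ℝ) : ℝ := (1 / (X.card : ℝ)) * ∑ x, f x * g x

def innL (X : Finset V) (f : X → ℝ) : (X → ℝ) →ₗ[ℝ] ℝ where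
  toFun g := inn X f g
  map_add' g h := by
    simp only [inn, Pi.add_apply, mul_add, Finset.sum_add_distrib]
  map_smul' c g := by
    simp only [inn, Pi.smul_apply, smul_eq_mul, RingHom.id_apply]
    rw [Finset.sum_congr rfl (fun x _ => by ring : ∀ x ∈ Finset.univ, f x * (c * g x) = c * (f x * g x)),
      ← Finset.mul_sum]
    ring

/-- The orthogonal complement of `W` with respect to `inn`. -/
def perp (X : Finset V) (W : Submodule ℝ (X → ℝ)) : Submodule ℝ (X → ℝ) :=
  ⨅ f ∈ W, LinearMap.ker (innL X f)

/-- The harmonic spaces `Harm_k(X)`. -/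
def Harm (X : Finset V) : ℕ → Submodule ℝ (X → ℝ)
  | 0 => Pol X 0
  | (k+1) => Pol X (k+1) ⊓ perp X (Pol X k)

/-- `F` is the matrix of the orthogonal projection of `C(X)` onto `W`
(with respect to the inner product `inn`). -/
def IsProjOnto (X : Finset V) (W : Submodule ℝ (X → ℝ)) (F : Matrix X X ℝ) : Prop :=
  (∀ f, F.mulVec f ∈ W) ∧ (∀ f ∈ W, F.mulVec f = f) ∧ (∀ f ∈ perp X W, F.mulVec f = 0)

/-- The degree `S` of `X`: the least `i` with `Pol_i(X) = C(X)`. -/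
def degS (X : Finset V) : ℕ := sInf {i | Pol X i = ⊤}

/-- `A(X)`, the set of inner products between distinct points of `X`. -/
def Aset (X : Finset V) : Finset ℝ :=
  ((X ×ˢ X).filter fun p => p.1 ≠ p.2).image fun p => ⟪p.1, p.2⟫_ℝ

/-- `A'(X) = A(X) ∪ {m}`. -/
def Aset' (m : ℝ) (X : Finset V) : Finset ℝ := insert m (Aset X)

/-- `κ_α`, the number of ordered pairs of points of `X` with inner product `α`. -/
def kappa (X : Finset V) (α : ℝ) : ℕ := ((X ×ˢ X).filter fun p => ⟪p.1, p.2⟫_ℝ = α).card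

/-- The inner product `⟨p,q⟩ = (1/n²) ∑_{α ∈ A'(X)} κ_α p(α) q(α)` on polynomials. -/
def pInn (m : ℝ) (X : Finset V) (p q : Polynomial ℝ) : ℝ :=
  (1 / (X.card : ℝ) ^ 2) * ∑ α ∈ Aset' m X, (kappa X α : ℝ) * (p.eval α * q.eval α)

/-- `q` is the family of predegree polynomials of `X`. -/
def IsPredegree (m : ℝ) (X : Finset V) (s : ℕ) (q : ℕ → Polynomial ℝ) : Prop :=
  (∀ k ≤ s, (q k).natDegree = k ∧ q k ≠ 0) ∧
  (∀ k ≤ s, ∀ h ≤ s, pInn m X (q k) (q h) = if k = h then (q k).eval m else 0)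

/-- The relation matrix `A_α` of `X`. -/
def relMat (X : Finset V) (α : ℝ) : Matrix X X ℝ :=
  Matrix.of fun x y => if ⟪(x : V), (y : V)⟫_ℝ = α then 1 else 0

/-- `X` carries the structure of a `Q`-polynomial association scheme with respect to
the idempotents `F_0, …, F_s` (whose relations are given by the inner products). -/
def CarriesQPolyScheme (m : ℝ) (X : Finset V) (s : ℕ) (F : ℕ → Matrix X X ℝ) : Prop :=
  (∀ α ∈ Aset' m X, ∀ β ∈ Aset' m X, relMat X α * relMat X β ∈
      Submodule.span ℝ (relMat X '' (Aset' m X : Set ℝ))) ∧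
  (∀ i ≤ s, F i ∈ Submodule.span ℝ (relMat X '' (Aset' m X : Set ℝ))) ∧
  (∀ i ≤ s, ∀ j ≤ s, F i * F j = if i = j then F i else 0) ∧
  (∑ i ∈ Finset.range (s + 1), F i = 1) ∧
  (F 0 = Matrix.of fun _ _ => 1 / (X.card : ℝ)) ∧
  (∀ i ≤ s, ∃ v : Polynomial ℝ, v.natDegree = i ∧
      F i = Matrix.of fun x y => (1 / (X.card : ℝ)) * v.eval ((X.card : ℝ) * F 1 x y))


section Projections

variable {E : Type*} {X : Finset E} {W : Submodule ℝ (X → ℝ)} {P : Matrix X X ℝ}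

theorem mem_perp_iff (hne : X.Nonempty) {f : X → ℝ} :
    f ∈ perp X W ↔ ∀ w ∈ W, w ⬝ᵥ f = 0 := by
  have hn : (X.card : ℝ) ≠ 0 := by exact_mod_cast hne.card_pos.ne'
  simp [perp, innL, inn, dotProduct, hn]

theorem exists_mem_add_perp (hne : X.Nonempty) (W : Submodule ℝ (X → ℝ)) (f : X → ℝ) :
    ∃ w ∈ W, ∃ u ∈ perp X W, f = w + u := by
  let e := (WithLp.linearEquiv 2 ℝ (X → ℝ)).symm
  let W' : Submodule ℝ (EuclideanSpace ℝ X) := W.map e.toLinearMap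
  have hP := W'.starProjection_apply_mem (e f)
  obtain ⟨w, hw, hwe⟩ := hP
  refine ⟨w, hw, f - w, (mem_perp_iff hne).2 fun v hv => ?_, by abel⟩
  have h := W'.sub_starProjection_mem_orthogonal (e f)
  rw [Submodule.mem_orthogonal] at h
  have h2 := h (e v) ⟨v, hv, rfl⟩
  rw [← hwe] at h2
  have h3 : e f - e.toLinearMap w = e (f - w) := by simp
  rw [h3, EuclideanSpace.inner_eq_star_dotProduct] at h2
  rw [dotProduct_comm]
  simpa [e] using h2

theorem mem_of_forall_perp (hne : X.Nonempty) {f : X → ℝ}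
    (h : ∀ g ∈ perp X W, g ⬝ᵥ f = 0) : f ∈ W := by
  obtain ⟨w, hw, u, hu, rfl⟩ := exists_mem_add_perp hne W f
  have h1 := h u hu
  rw [dotProduct_add, dotProduct_comm u w, (mem_perp_iff hne).1 hu w hw, zero_add,
    dotProduct_self_eq_zero] at h1
  simpa [h1] using hw

theorem sub_mulVec_mem_perp (hne : X.Nonempty) (hP : IsProjOnto X W P) (f : X → ℝ) :
    f - P.mulVec f ∈ perp X W := by
  obtain ⟨w, hw, u, hu, rfl⟩ := exists_mem_add_perp hne W f
  rw [Matrix.mulVec_add, hP.2.1 w hw, hP.2.2 u hu]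
  simpa using hu

theorem mulVec_dotProduct_mulVec (hne : X.Nonempty) (hP : IsProjOnto X W P) (f g : X → ℝ) :
    P.mulVec f ⬝ᵥ P.mulVec g = P.mulVec f ⬝ᵥ g := by
  have h := (mem_perp_iff hne).1 (sub_mulVec_mem_perp hne hP g) _ (hP.1 f)
  rw [dotProduct_sub] at h
  linarith

theorem transpose_eq_of_isProjOnto (hne : X.Nonempty) (hP : IsProjOnto X W P) : P.transpose = P := by
  ext x y
  have h : P.mulVec (Pi.single x 1) ⬝ᵥ Pi.single y 1 =
      P.mulVec (Pi.single y 1) ⬝ᵥ Pi.single x 1 := by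
    rw [← mulVec_dotProduct_mulVec hne hP, dotProduct_comm, mulVec_dotProduct_mulVec hne hP]
  simpa using h

theorem isProjOnto_unique (hne : X.Nonempty) {R : Matrix X X ℝ}
    (hP : IsProjOnto X W P) (hR : IsProjOnto X W R) : P = R := by
  refine Matrix.ext_of_mulVec_single fun x => ?_
  set f : X → ℝ := Pi.single x 1
  have h := hP.2.2 _ (sub_mulVec_mem_perp hne hR f)
  rw [Matrix.mulVec_sub, hP.2.1 _ (hR.1 f)] at h
  exact sub_eq_zero.1 h

theorem isProjOnto_mul_self (hP : IsProjOnto X W P) : P * P = P := by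
  refine Matrix.ext_of_mulVec_single fun x => ?_
  rw [← Matrix.mulVec_mulVec]
  exact hP.2.1 _ (hP.1 _)

end Projections

section Harmonics

variable {X : Finset V} {F : ℕ → Matrix X X ℝ}

theorem Pol_mono (X : Finset V) : Monotone (Pol X) := by
  intro i j hij
  refine Submodule.span_mono ?_
  rintro f ⟨a, ha, p, hp, rfl⟩
  exact ⟨a, ha, p, hp.trans hij, rfl⟩

theorem Harm_le_Pol (X : Finset V) (k : ℕ) : Harm X k ≤ Pol X k := by
  cases k with
  | zero => exact le_rfl
  | succ k => exact inf_le_left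

theorem Pol_le_perp_Harm (hne : X.Nonempty) {i k : ℕ} (h : i < k) :
    Pol X i ≤ perp X (Harm X k) := by
  obtain ⟨k, rfl⟩ := Nat.exists_eq_succ_of_ne_zero (Nat.ne_zero_of_lt h)
  intro f hf
  refine (mem_perp_iff hne).2 fun w hw => ?_
  rw [dotProduct_comm]
  exact (mem_perp_iff hne).1 hw.2 f (Pol_mono X (Nat.lt_succ_iff.1 h) hf)

theorem Harm_le_perp_Harm (hne : X.Nonempty) {i k : ℕ} (h : i ≠ k) :
    Harm X i ≤ perp X (Harm X k) := by
  rcases lt_or_gt_of_ne h with h | h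
  · exact (Harm_le_Pol X i).trans (Pol_le_perp_Harm hne h)
  · intro f hf
    refine (mem_perp_iff hne).2 fun w hw => ?_
    rw [dotProduct_comm]
    exact (mem_perp_iff hne).1 (Pol_le_perp_Harm hne h (Harm_le_Pol X k hw)) f hf

theorem harmProj_mul (hne : X.Nonempty) (hF : ∀ i, IsProjOnto X (Harm X i) (F i)) (i j : ℕ) :
    F i * F j = if i = j then F i else 0 := by
  split_ifs with h
  · rw [← h, isProjOnto_mul_self (hF i)]
  · refine Matrix.ext_of_mulVec_single fun x => ?_
    rw [← Matrix.mulVec_mulVec, Matrix.zero_mulVec]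
    exact (hF i).2.2 _ (Harm_le_perp_Harm hne (Ne.symm h) ((hF j).1 _))

theorem sum_harmProj_mulVec (hne : X.Nonempty) (hF : ∀ i, IsProjOnto X (Harm X i) (F i)) (k : ℕ)
    {f : X → ℝ} (hf : f ∈ Pol X k) : (∑ i ∈ Finset.range (k + 1), F i).mulVec f = f := by
  induction k generalizing f with
  | zero => simpa using (hF 0).2.1 f hf
  | succ k ih =>
    obtain ⟨w, hw, u, hu, rfl⟩ := exists_mem_add_perp hne (Pol X k) f
    have huH : u ∈ Harm X (k + 1) := by
      refine ⟨?_, hu⟩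
      have := Submodule.sub_mem _ hf (Pol_mono X (Nat.le_succ k) hw)
      simpa using this
    have hsum : (∑ i ∈ Finset.range (k + 1), F i).mulVec u = 0 := by
      rw [Matrix.sum_mulVec]
      refine Finset.sum_eq_zero fun i hi => (hF i).2.2 _ ?_
      exact Harm_le_perp_Harm hne (by have := Finset.mem_range.1 hi; omega) huH
    rw [Finset.sum_range_succ, Matrix.add_mulVec, Matrix.mulVec_add, Matrix.mulVec_add, ih hw, hsum,
      (hF (k + 1)).2.1 u huH, (hF (k + 1)).2.2 w (Pol_le_perp_Harm hne (Nat.lt_succ_self k) hw)]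
    simp

/-- The matrix `(1/n) p(⟪x, y⟫)` of a zonal polynomial, as a linear function of `p`. -/
def zonalMat (X : Finset V) : Polynomial ℝ →ₗ[ℝ] Matrix X X ℝ where
  toFun p := Matrix.of fun x y => (1 / (X.card : ℝ)) * p.eval ⟪(x : V), (y : V)⟫_ℝ
  map_add' p r := by ext x y; simp [mul_add]
  map_smul' c p := by ext x y; simp; ring

theorem zonalMat_apply (p : Polynomial ℝ) (x y : X) :
    zonalMat X p x y = (1 / (X.card : ℝ)) * p.eval ⟪(x : V), (y : V)⟫_ℝ := rfl

theorem zonalMat_transpose (p : Polynomial ℝ) : (zonalMat X p).transpose = zonalMat X p := by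
  ext x y
  simp [zonalMat_apply, real_inner_comm]

theorem zonalMat_mulVec_mem (p : Polynomial ℝ) {k : ℕ} (hp : p.natDegree ≤ k) (f : X → ℝ) :
    (zonalMat X p).mulVec f ∈ Pol X k := by
  have h : (zonalMat X p).mulVec f =
      ∑ y : X, (1 / (X.card : ℝ) * f y) • fun x : X => p.eval ⟪(y : V), x.1⟫_ℝ := by
    ext x
    simp only [Matrix.mulVec, dotProduct, zonalMat_apply, Finset.sum_apply, Pi.smul_apply,
      smul_eq_mul]
    refine Finset.sum_congr rfl fun y _ => ?_
    rw [real_inner_comm]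
    ring
  rw [h]
  exact Submodule.sum_mem _ fun y _ => Submodule.smul_mem _ _
    (Submodule.subset_span ⟨y, y.2, p, hp, rfl⟩)

theorem harmProj_mul_zonalMat (hne : X.Nonempty) (hF : ∀ i, IsProjOnto X (Harm X i) (F i)) {i : ℕ}
    {p : Polynomial ℝ} (hp : p.natDegree < i) : F i * zonalMat X p = 0 := by
  refine Matrix.ext_of_mulVec_single fun x => ?_
  rw [← Matrix.mulVec_mulVec, Matrix.zero_mulVec]
  exact (hF i).2.2 _ (Pol_le_perp_Harm hne hp (zonalMat_mulVec_mem p le_rfl _))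

theorem zonalMat_mul_harmProj (hne : X.Nonempty) (hF : ∀ i, IsProjOnto X (Harm X i) (F i)) {i : ℕ}
    {p : Polynomial ℝ} (hp : p.natDegree < i) : zonalMat X p * F i = 0 := by
  have h := congrArg Matrix.transpose (harmProj_mul_zonalMat hne hF hp)
  rwa [Matrix.transpose_mul, zonalMat_transpose, transpose_eq_of_isProjOnto hne (hF i),
    Matrix.transpose_zero] at h

/-- For a spherical 2-design the projection onto `Harm_1(X)` is the normalized Gram matrix. -/
theorem harmProj_one (hne : X.Nonempty) (hdes : IsTwoDesign X)
    (hF : ∀ i, IsProjOnto X (Harm X i) (F i)) : F 1 = zonalMat X Polynomial.X := by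
  have hn : (X.card : ℝ) ≠ 0 := by exact_mod_cast hne.card_pos.ne'
  set G := zonalMat X Polynomial.X with hG
  have hconst : ∀ c : ℝ, G.mulVec (fun _ => c) = 0 := by
    intro c
    ext x
    have h := hdes.1 x x.2
    rw [← Finset.sum_coe_sort] at h
    simp only [Matrix.mulVec, dotProduct, hG, zonalMat_apply, Polynomial.eval_X, ← Finset.sum_mul,
      ← Finset.mul_sum, h]
    simp
  have hidem : G * G = G := by
    ext x y
    have h := hdes.2 x x.2 y y.2
    rw [← Finset.sum_coe_sort] at h
    simp only [Matrix.mul_apply, hG, zonalMat_apply, Polynomial.eval_X]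
    rw [← h, Finset.mul_sum, Finset.mul_sum]
    refine Finset.sum_congr rfl fun z _ => by ring
  have hGT : G.transpose = G := zonalMat_transpose _
  have hdot : ∀ f g : X → ℝ, G.mulVec f ⬝ᵥ g = f ⬝ᵥ G.mulVec g := by
    intro f g
    rw [Matrix.dotProduct_mulVec, ← Matrix.mulVec_transpose, hGT]
  have hmem : ∀ f, G.mulVec f ∈ Harm X 1 := by
    intro f
    refine ⟨zonalMat_mulVec_mem _ Polynomial.natDegree_X_le f, (mem_perp_iff hne).2 fun w hw => ?_⟩
    rw [← hdot]
    have : G.mulVec w = 0 := by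
      change w ∈ LinearMap.ker G.mulVecLin
      refine (Submodule.span_le.2 ?_) hw
      rintro _ ⟨a, ha, p, hp, rfl⟩
      rw [Polynomial.eq_C_of_natDegree_le_zero hp]
      simpa using hconst _
    simp [this]
  have hPol : ∀ f ∈ Pol X 1, ∃ c : ℝ, f - G.mulVec f = fun _ => c := by
    intro f hf
    induction hf using Submodule.span_induction with
    | mem f hf =>
      obtain ⟨a, ha, p, hp, rfl⟩ := hf
      obtain ⟨c, d, rfl⟩ := Polynomial.exists_eq_X_add_C_of_natDegree_le_one hp
      have h1 : (fun x : X => (Polynomial.C c * Polynomial.X + Polynomial.C d).eval ⟪a, x.1⟫_ℝ) =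
          (c * X.card) • G.mulVec (Pi.single ⟨a, ha⟩ 1) + fun _ => d := by
        ext x
        simp [hG, zonalMat_apply, real_inner_comm]
        field_simp
      refine ⟨d, ?_⟩
      rw [h1, Matrix.mulVec_add, hconst, Matrix.mulVec_smul, Matrix.mulVec_mulVec, hidem]
      simp
    | zero => exact ⟨0, by simp; rfl⟩
    | add f g _ _ hf hg =>
      obtain ⟨c, hc⟩ := hf
      obtain ⟨d, hd⟩ := hg
      refine ⟨c + d, ?_⟩
      rw [Matrix.mulVec_add, add_sub_add_comm, hc, hd]
      rfl
    | smul a f _ hf =>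
      obtain ⟨c, hc⟩ := hf
      refine ⟨a * c, ?_⟩
      rw [Matrix.mulVec_smul, ← smul_sub, hc]
      rfl
  refine isProjOnto_unique hne (hF 1) ⟨hmem, fun f hf => ?_, fun f hf => ?_⟩
  · obtain ⟨c, hc⟩ := hPol f hf.1
    have h1 : f - G.mulVec f ∈ perp X (Pol X 0) := Submodule.sub_mem _ hf.2 (hmem f).2
    have h2 : f - G.mulVec f ∈ Pol X 0 := by
      rw [hc]
      obtain ⟨a, ha⟩ := hne
      exact Submodule.subset_span ⟨a, ha, Polynomial.C c, by simp, by simp⟩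
    have h3 := (mem_perp_iff hne).1 h1 _ h2
    rw [dotProduct_self_eq_zero, sub_eq_zero] at h3
    exact h3.symm
  · rw [← dotProduct_self_eq_zero, hdot, Matrix.mulVec_mulVec, hidem, dotProduct_comm]
    exact (mem_perp_iff hne).1 hf _ (hmem f)

end Harmonics

section Multiplication

/-- The zonal powers of degree `k` have the same orthogonal complement as the monomials of
degree `k`. -/
theorem sum_mul_prod_eq_zero {m k : ℕ} {X : Finset (EuclideanSpace ℝ (Fin m))} {g : X → ℝ}
    (h : ∀ c : X, ∑ x : X, g x * ⟪(c : EuclideanSpace ℝ (Fin m)), x.1⟫_ℝ ^ k = 0)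
    (I : Fin k → Fin m) : ∑ x : X, g x * ∏ j, x.1 (I j) = 0 := by
  have hpow : ∀ c x : X, ⟪(c : EuclideanSpace ℝ (Fin m)), x.1⟫_ℝ ^ k =
      ∑ J : Fin k → Fin m, (∏ j, c.1 (J j)) * ∏ j, x.1 (J j) := by
    intro c x
    rw [PiLp.inner_apply, Fintype.sum_pow]
    refine Finset.sum_congr rfl fun J _ => ?_
    rw [← Finset.prod_mul_distrib]
    exact Finset.prod_congr rfl fun j _ => by simp [mul_comm]
  have hsq : ∑ J : Fin k → Fin m, (∑ x : X, g x * ∏ j, x.1 (J j)) ^ 2 = 0 := by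
    calc _ = ∑ J : Fin k → Fin m, ∑ c : X, ∑ x : X,
          (g c * ∏ j, c.1 (J j)) * (g x * ∏ j, x.1 (J j)) := by
            simp_rw [sq, Finset.sum_mul_sum]
      _ = ∑ c : X, ∑ x : X, ∑ J : Fin k → Fin m,
          (g c * ∏ j, c.1 (J j)) * (g x * ∏ j, x.1 (J j)) := by
            rw [Finset.sum_comm]
            exact Finset.sum_congr rfl fun c _ => Finset.sum_comm
      _ = ∑ c : X, g c * ∑ x : X, g x * ⟪(c : EuclideanSpace ℝ (Fin m)), x.1⟫_ℝ ^ k := by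
            refine Finset.sum_congr rfl fun c _ => ?_
            rw [Finset.mul_sum]
            refine Finset.sum_congr rfl fun x _ => ?_
            rw [hpow, Finset.mul_sum, Finset.mul_sum]
            exact Finset.sum_congr rfl fun J _ => by ring
      _ = 0 := Finset.sum_eq_zero fun c _ => by rw [h c, mul_zero]
  have := (Finset.sum_eq_zero_iff_of_nonneg fun J _ => sq_nonneg _).1 hsq I (Finset.mem_univ I)
  exact pow_eq_zero_iff two_ne_zero |>.1 this

theorem pow_mul_inner_mem_Pol {m : ℕ} {X : Finset (EuclideanSpace ℝ (Fin m))} (hne : X.Nonempty)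
    (k : ℕ) (a b : EuclideanSpace ℝ (Fin m)) :
    (fun x : X => ⟪a, x.1⟫_ℝ ^ k * ⟪b, x.1⟫_ℝ) ∈ Pol X (k + 1) := by
  refine mem_of_forall_perp hne fun g hg => ?_
  have hz : ∀ c : X, ∑ x : X, g x * ⟪(c : EuclideanSpace ℝ (Fin m)), x.1⟫_ℝ ^ (k + 1) = 0 := by
    intro c
    have := (mem_perp_iff hne).1 hg
      (fun x : X => ⟪(c : EuclideanSpace ℝ (Fin m)), x.1⟫_ℝ ^ (k + 1))
      (Submodule.subset_span ⟨c, c.2, Polynomial.X ^ (k + 1), by simp, by simp⟩)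
    rw [dotProduct_comm] at this
    exact this
  have hexp : ∀ x : X, ⟪a, x.1⟫_ℝ ^ k * ⟪b, x.1⟫_ℝ = ∑ i : Fin m, ∑ J : Fin k → Fin m,
      (b i * ∏ j, a (J j)) * ∏ j, x.1 ((Fin.cons i J : Fin (k + 1) → Fin m) j) := by
    intro x
    rw [PiLp.inner_apply, PiLp.inner_apply, Fintype.sum_pow, mul_comm, Finset.sum_mul_sum]
    refine Finset.sum_congr rfl fun i _ => Finset.sum_congr rfl fun J _ => ?_
    simp [Fin.prod_univ_succ, Finset.prod_mul_distrib]
    ring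
  simp only [dotProduct, hexp, Finset.mul_sum]
  rw [Finset.sum_comm]
  refine Finset.sum_eq_zero fun i _ => ?_
  rw [Finset.sum_comm]
  refine Finset.sum_eq_zero fun J _ => ?_
  calc _ = (b i * ∏ j, a (J j)) *
        ∑ x : X, g x * ∏ j, x.1 ((Fin.cons i J : Fin (k + 1) → Fin m) j) := by
          rw [Finset.mul_sum]
          exact Finset.sum_congr rfl fun x _ => by ring
    _ = 0 := by rw [sum_mul_prod_eq_zero hz, mul_zero]

theorem mul_inner_mem_Pol {m : ℕ} {X : Finset (EuclideanSpace ℝ (Fin m))} (hne : X.Nonempty)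
    {k : ℕ} (b : EuclideanSpace ℝ (Fin m)) {f : X → ℝ} (hf : f ∈ Pol X k) :
    (fun x : X => f x * ⟪b, x.1⟫_ℝ) ∈ Pol X (k + 1) := by
  induction hf using Submodule.span_induction with
  | mem f hf =>
    obtain ⟨a, ha, p, hp, rfl⟩ := hf
    have h : (fun x : X => p.eval ⟪a, x.1⟫_ℝ * ⟪b, x.1⟫_ℝ) =
        ∑ i ∈ Finset.range (k + 1), p.coeff i • fun x : X => ⟪a, x.1⟫_ℝ ^ i * ⟪b, x.1⟫_ℝ := by
      ext x
      rw [Polynomial.eval_eq_sum_range' (Nat.lt_succ_of_le hp), Finset.sum_mul]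
      simp [mul_assoc]
    rw [h]
    refine Submodule.sum_mem _ fun i hi => Submodule.smul_mem _ _ ?_
    exact Pol_mono X (Finset.mem_range.1 hi) (pow_mul_inner_mem_Pol hne i a b)
  | zero =>
    convert Submodule.zero_mem (Pol X (k + 1)) using 1
    ext x
    simp
  | add f g _ _ hf hg =>
    convert Submodule.add_mem _ hf hg using 1
    ext x
    simp [add_mul]
  | smul a f _ hf =>
    convert Submodule.smul_mem _ a hf using 1
    ext x
    simp [mul_assoc]

end Multiplication

section Predegree

variable {X : Finset V} {m : ℝ} {s : ℕ} {q : ℕ → Polynomial ℝ}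

theorem inner_mem_Aset' (hsph : onSphere m X) (x y : X) :
    ⟪(x : V), (y : V)⟫_ℝ ∈ Aset' m X := by
  rw [Aset', Finset.mem_insert]
  by_cases h : x = y
  · left
    rw [h]
    exact hsph y y.2
  · right
    refine Finset.mem_image.2 ⟨(x, y), ?_, rfl⟩
    simpa using h

theorem exists_inner_of_mem_Aset' (hne : X.Nonempty) (hsph : onSphere m X) {α : ℝ}
    (hα : α ∈ Aset' m X) : ∃ x y : X, ⟪(x : V), (y : V)⟫_ℝ = α := by
  rw [Aset', Finset.mem_insert] at hα
  rcases hα with rfl | hα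
  · obtain ⟨x, hx⟩ := hne
    exact ⟨⟨x, hx⟩, ⟨x, hx⟩, hsph x hx⟩
  · obtain ⟨⟨x, y⟩, h, h2⟩ := Finset.mem_image.1 hα
    simp only [Finset.mem_filter, Finset.mem_product] at h
    exact ⟨⟨x, h.1.1⟩, ⟨y, h.1.2⟩, h2⟩

theorem inner_eq_iff (hsph : onSphere m X) (x y : X) : ⟪(x : V), (y : V)⟫_ℝ = m ↔ x = y := by
  refine ⟨fun h => ?_, fun h => by rw [h]; exact hsph y y.2⟩
  have h1 : ⟪(x : V) - y, (x : V) - y⟫_ℝ = 0 := by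
    rw [inner_sub_left, inner_sub_right, inner_sub_right, real_inner_comm (x : V) (y : V), h,
      hsph x x.2, hsph y y.2]
    ring
  exact Subtype.ext (sub_eq_zero.1 (inner_self_eq_zero.1 h1))

theorem card_Aset' (hsph : onSphere m X) : (Aset' m X).card = (Aset X).card + 1 := by
  refine Finset.card_insert_of_notMem fun h => ?_
  obtain ⟨⟨x, y⟩, h, h2⟩ := Finset.mem_image.1 h
  simp only [Finset.mem_filter, Finset.mem_product] at h
  exact h.2 (congrArg Subtype.val ((inner_eq_iff hsph ⟨x, h.1.1⟩ ⟨y, h.1.2⟩).1 h2))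

theorem exists_interpolation (hsph : onSphere m X) (hs : (Aset X).card = s) (r : ℝ → ℝ) :
    ∃ p : Polynomial ℝ, p.natDegree ≤ s ∧ ∀ α ∈ Aset' m X, p.eval α = r α := by
  have hinj : Set.InjOn (id : ℝ → ℝ) (Aset' m X) := Function.injective_id.injOn
  refine ⟨Lagrange.interpolate (Aset' m X) id r, ?_, fun α hα =>
    Lagrange.eval_interpolate_at_node r hinj hα⟩
  have h := Lagrange.degree_interpolate_lt r hinj
  rw [card_Aset' hsph, hs] at h
  exact Polynomial.natDegree_le_of_degree_le (Order.le_of_lt_succ h)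

theorem pInn_eq_trace (hsph : onSphere m X) (p r : Polynomial ℝ) :
    pInn m X p r = Matrix.trace (zonalMat X p * zonalMat X r) := by
  have hsum : ∑ α ∈ Aset' m X, (kappa X α : ℝ) * (p.eval α * r.eval α) =
      ∑ z ∈ X ×ˢ X, p.eval ⟪z.1, z.2⟫_ℝ * r.eval ⟪z.1, z.2⟫_ℝ := by
    rw [← Finset.sum_fiberwise_of_maps_to (t := Aset' m X) (g := fun z : V × V => ⟪z.1, z.2⟫_ℝ)]
    · refine Finset.sum_congr rfl fun α _ => ?_
      rw [Finset.sum_congr rfl (g := fun _ => p.eval α * r.eval α), Finset.sum_const, nsmul_eq_mul,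
        kappa]
      intro z hz
      rw [(Finset.mem_filter.1 hz).2]
    · intro z hz
      rw [Finset.mem_product] at hz
      exact inner_mem_Aset' hsph ⟨z.1, hz.1⟩ ⟨z.2, hz.2⟩
  rw [pInn, hsum, Finset.sum_product, ← Finset.sum_coe_sort, Matrix.trace, Finset.mul_sum]
  refine Finset.sum_congr rfl fun x _ => ?_
  rw [← Finset.sum_coe_sort, Matrix.diag_apply, Matrix.mul_apply, Finset.mul_sum]
  refine Finset.sum_congr rfl fun y _ => ?_
  rw [zonalMat_apply, zonalMat_apply, real_inner_comm (x : V) (y : V)]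
  ring

theorem trace_zonalMat (hne : X.Nonempty) (hsph : onSphere m X) (p : Polynomial ℝ) :
    Matrix.trace (zonalMat X p) = p.eval m := by
  have hn : (X.card : ℝ) ≠ 0 := by exact_mod_cast hne.card_pos.ne'
  have : ∀ x : X, zonalMat X p x x = 1 / (X.card : ℝ) * p.eval m := fun x => by
    rw [zonalMat_apply, hsph x x.2]
  simp only [Matrix.trace, Matrix.diag_apply, this]
  simp
  field_simp

theorem zonalMat_congr (hsph : onSphere m X) {p r : Polynomial ℝ}
    (h : ∀ α ∈ Aset' m X, p.eval α = r.eval α) : zonalMat X p = zonalMat X r := by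
  ext x y
  rw [zonalMat_apply, zonalMat_apply, h _ (inner_mem_Aset' hsph x y)]

theorem exists_eq_sum_predegree (hq : IsPredegree m X s q) {k : ℕ} (hk : k ≤ s) {p : Polynomial ℝ}
    (hp : p.natDegree ≤ k) :
    ∃ d : ℕ → ℝ, p = ∑ j ∈ Finset.range (k + 1), d j • q j := by
  induction k generalizing p with
  | zero =>
    obtain ⟨h1, h2⟩ := hq.1 0 hk
    obtain ⟨a, ha⟩ := Polynomial.natDegree_eq_zero.1 h1
    obtain ⟨b, rfl⟩ := Polynomial.natDegree_eq_zero.1 (Nat.le_zero.1 hp)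
    have ha0 : a ≠ 0 := by
      rintro rfl
      exact h2 (by rw [← ha]; simp)
    refine ⟨fun _ => b / a, ?_⟩
    simp [← ha, Polynomial.smul_C, ha0]
  | succ k ih =>
    obtain ⟨h1, h2⟩ := hq.1 (k + 1) hk
    have hlc : (q (k + 1)).coeff (k + 1) ≠ 0 := by
      have := Polynomial.leadingCoeff_ne_zero.2 h2
      rwa [Polynomial.leadingCoeff, h1] at this
    set c := p.coeff (k + 1) / (q (k + 1)).coeff (k + 1) with hc
    have hdeg : (p - c • q (k + 1)).natDegree ≤ k := by
      rw [Polynomial.natDegree_le_iff_coeff_eq_zero]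
      intro N hN
      rw [Polynomial.coeff_sub, Polynomial.coeff_smul, smul_eq_mul]
      rcases Nat.lt_or_ge (k + 1) N with h | h
      · rw [Polynomial.coeff_eq_zero_of_natDegree_lt (by omega),
          Polynomial.coeff_eq_zero_of_natDegree_lt (by omega)]
        simp
      · obtain rfl : N = k + 1 := by omega
        rw [hc, div_mul_cancel₀ _ hlc, sub_self]
    obtain ⟨d, hd⟩ := ih (by omega) hdeg
    refine ⟨Function.update d (k + 1) c, ?_⟩
    rw [Finset.sum_range_succ, Function.update_self, Finset.sum_congr rfl
      (g := fun j => d j • q j), ← hd, sub_add_cancel]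
    intro j hj
    rw [Function.update_of_ne (by have := Finset.mem_range.1 hj; omega)]

theorem trace_zonalMat_sum_mul (hsph : onSphere m X) (hq : IsPredegree m X s q) {k : ℕ}
    (hk : k ≤ s) (d : ℕ → ℝ) {i : ℕ} (hi : i ≤ s) :
    Matrix.trace (zonalMat X (∑ j ∈ Finset.range (k + 1), d j • q j) * zonalMat X (q i)) =
      if i ≤ k then d i * (q i).eval m else 0 := by
  rw [map_sum, Finset.sum_mul, Matrix.trace_sum]
  have h : ∀ j ∈ Finset.range (k + 1), Matrix.trace (zonalMat X (d j • q j) * zonalMat X (q i)) =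
      if i = j then d i * (q i).eval m else 0 := by
    intro j hj
    have hj := Finset.mem_range.1 hj
    rw [map_smul, Matrix.smul_mul, Matrix.trace_smul, ← pInn_eq_trace hsph,
      hq.2 j (by omega) i hi]
    by_cases hij : i = j
    · simp [hij]
    · simp [hij, Ne.symm hij]
  rw [Finset.sum_congr rfl h, Finset.sum_ite_eq]
  simp

theorem predegree_eval_ne_zero (hne : X.Nonempty) (hsph : onSphere m X) (hs : (Aset X).card = s)
    (hq : IsPredegree m X s q) {k : ℕ} (hk : k ≤ s) : (q k).eval m ≠ 0 := by
  intro h0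
  have hn : (X.card : ℝ) ≠ 0 := by exact_mod_cast hne.card_pos.ne'
  have h := hq.2 k hk k hk
  rw [if_pos rfl, h0, pInn_eq_trace hsph] at h
  nth_rewrite 1 [← zonalMat_transpose] at h
  have hM : zonalMat X (q k) = 0 := by
    rwa [← Matrix.conjTranspose_eq_transpose_of_trivial,
      Matrix.trace_conjTranspose_mul_self_eq_zero_iff] at h
  refine (hq.1 k hk).2 (Polynomial.eq_zero_of_natDegree_lt_card_of_eval_eq_zero' (q k)
    (Aset' m X) (fun α hα => ?_) ?_)
  · obtain ⟨x, y, rfl⟩ := exists_inner_of_mem_Aset' hne hsph hα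
    have := congrFun (congrFun hM x) y
    rw [zonalMat_apply] at this
    simpa [hn, hne.ne_empty] using this
  · rw [card_Aset' hsph, hs, (hq.1 k hk).1]
    omega

/-- Fourier expansion of a zonal matrix in the predegree polynomials. -/
theorem zonalMat_eq_sum (hne : X.Nonempty) (hsph : onSphere m X) (hs : (Aset X).card = s)
    (hq : IsPredegree m X s q) (p : Polynomial ℝ) :
    zonalMat X p = ∑ j ∈ Finset.range (s + 1),
      (Matrix.trace (zonalMat X p * zonalMat X (q j)) / (q j).eval m) • zonalMat X (q j) := by
  obtain ⟨r, hr, hrp⟩ := exists_interpolation hsph hs fun α => p.eval α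
  obtain ⟨d, rfl⟩ := exists_eq_sum_predegree hq le_rfl hr
  rw [← zonalMat_congr hsph hrp]
  have h : ∀ j ∈ Finset.range (s + 1), (Matrix.trace (zonalMat X (∑ j ∈ Finset.range (s + 1),
      d j • q j) * zonalMat X (q j)) / (q j).eval m) • zonalMat X (q j) =
      zonalMat X (d j • q j) := by
    intro j hj
    have hj : j ≤ s := Nat.lt_succ_iff.1 (Finset.mem_range.1 hj)
    rw [trace_zonalMat_sum_mul hsph hq le_rfl d hj, if_pos hj,
      mul_div_cancel_right₀ _ (predegree_eval_ne_zero hne hsph hs hq hj), map_smul]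
  rw [Finset.sum_congr rfl h, ← map_sum]

theorem exists_zonalMat_eq_relMat (hne : X.Nonempty) (hsph : onSphere m X)
    (hs : (Aset X).card = s) (α : ℝ) :
    ∃ p : Polynomial ℝ, p.natDegree ≤ s ∧ zonalMat X p = relMat X α := by
  have hn : (X.card : ℝ) ≠ 0 := by exact_mod_cast hne.card_pos.ne'
  obtain ⟨p, hp, h⟩ := exists_interpolation hsph hs fun β => if β = α then (X.card : ℝ) else 0
  refine ⟨p, hp, ?_⟩
  ext x y
  rw [zonalMat_apply, h _ (inner_mem_Aset' hsph x y), relMat, Matrix.of_apply]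
  split_ifs <;> simp [hn]

theorem relMat_eq_one (hsph : onSphere m X) : relMat X m = 1 := by
  ext x y
  rw [relMat, Matrix.of_apply, Matrix.one_apply]
  exact if_congr (inner_eq_iff hsph x y) rfl rfl

theorem zonalMat_mem_span (hsph : onSphere m X) (p : Polynomial ℝ) :
    zonalMat X p ∈ Submodule.span ℝ (relMat X '' (Aset' m X : Set ℝ)) := by
  have h : zonalMat X p = ∑ α ∈ Aset' m X, (1 / (X.card : ℝ) * p.eval α) • relMat X α := by
    ext x y
    simp only [Matrix.sum_apply, Matrix.smul_apply, relMat, Matrix.of_apply, smul_eq_mul, mul_ite,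
      mul_one, mul_zero, Finset.sum_ite_eq, if_pos (inner_mem_Aset' hsph x y), zonalMat_apply]
  rw [h]
  exact Submodule.sum_mem _ fun α hα => Submodule.smul_mem _ _
    (Submodule.subset_span ⟨α, hα, rfl⟩)

theorem sum_zonalMat_predegree (hne : X.Nonempty) (hsph : onSphere m X) (hs : (Aset X).card = s)
    (hq : IsPredegree m X s q) : ∑ j ∈ Finset.range (s + 1), zonalMat X (q j) = 1 := by
  obtain ⟨p, -, hp⟩ := exists_zonalMat_eq_relMat hne hsph hs m
  rw [relMat_eq_one hsph] at hp
  have h := zonalMat_eq_sum hne hsph hs hq p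
  rw [hp] at h
  rw [h]
  refine Finset.sum_congr rfl fun j hj => ?_
  have hj : j ≤ s := Nat.lt_succ_iff.1 (Finset.mem_range.1 hj)
  rw [one_mul, trace_zonalMat hne hsph, div_self (predegree_eval_ne_zero hne hsph hs hq hj),
    one_smul]

theorem Pol_eq_top (hne : X.Nonempty) (hsph : onSphere m X) (hs : (Aset X).card = s) :
    Pol X s = ⊤ := by
  obtain ⟨p, hp, h⟩ := exists_zonalMat_eq_relMat hne hsph hs m
  rw [relMat_eq_one hsph] at h
  refine eq_top_iff.2 fun f _ => ?_
  have := zonalMat_mulVec_mem p hp f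
  rwa [h, Matrix.one_mulVec] at this

theorem trace_X_mul_predegree_of_lt (hsph : onSphere m X) (hq : IsPredegree m X s q) {j k : ℕ}
    (hk : k ≤ s) (hjk : j + 1 < k) :
    Matrix.trace (zonalMat X (Polynomial.X * q k) * zonalMat X (q j)) = 0 := by
  have hdeg : (Polynomial.X * q j).natDegree ≤ j + 1 := by
    rw [Polynomial.natDegree_X_mul (hq.1 j (by omega)).2, (hq.1 j (by omega)).1]
  obtain ⟨d, hd⟩ := exists_eq_sum_predegree hq (by omega) hdeg
  have h : pInn m X (Polynomial.X * q k) (q j) = pInn m X (Polynomial.X * q j) (q k) := by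
    simp only [pInn, Polynomial.eval_mul, Polynomial.eval_X]
    congr 1
    exact Finset.sum_congr rfl fun α _ => by ring
  rw [← pInn_eq_trace hsph, h, pInn_eq_trace hsph, hd,
    trace_zonalMat_sum_mul hsph hq (by omega) d hk, if_neg (by omega)]

theorem trace_X_mul_predegree_succ_ne_zero (hne : X.Nonempty) (hsph : onSphere m X)
    (hs : (Aset X).card = s) (hq : IsPredegree m X s q) {l : ℕ} (hl : l + 1 ≤ s) :
    Matrix.trace (zonalMat X (Polynomial.X * q (l + 1)) * zonalMat X (q l)) ≠ 0 := by
  have hdeg : (Polynomial.X * q l).natDegree = l + 1 := by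
    rw [Polynomial.natDegree_X_mul (hq.1 l (by omega)).2, (hq.1 l (by omega)).1]
  obtain ⟨d, hd⟩ := exists_eq_sum_predegree hq hl hdeg.le
  have h : pInn m X (Polynomial.X * q (l + 1)) (q l) =
      pInn m X (Polynomial.X * q l) (q (l + 1)) := by
    simp only [pInn, Polynomial.eval_mul, Polynomial.eval_X]
    congr 1
    exact Finset.sum_congr rfl fun α _ => by ring
  rw [← pInn_eq_trace hsph, h, pInn_eq_trace hsph, hd, trace_zonalMat_sum_mul hsph hq hl d hl,
    if_pos le_rfl]
  refine mul_ne_zero (fun h0 => ?_) (predegree_eval_ne_zero hne hsph hs hq hl)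
  rw [Finset.sum_range_succ, h0, zero_smul, add_zero] at hd
  have hle : (Polynomial.X * q l).natDegree ≤ l := by
    rw [hd]
    refine Polynomial.natDegree_sum_le_of_forall_le _ _ fun j hj => ?_
    have hj := Finset.mem_range.1 hj
    refine (Polynomial.natDegree_smul_le _ _).trans ?_
    rw [(hq.1 j (by omega)).1]
    omega
  omega

end Predegree

section Excess

variable {X : Finset V} {m : ℝ} {s : ℕ} {q : ℕ → Polynomial ℝ} {F : ℕ → Matrix X X ℝ}

theorem sum_harmProj (hne : X.Nonempty) (hsph : onSphere m X) (hs : (Aset X).card = s)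
    (hF : ∀ i, IsProjOnto X (Harm X i) (F i)) : ∑ i ∈ Finset.range (s + 1), F i = 1 := by
  refine Matrix.ext_of_mulVec_single fun x => ?_
  rw [Matrix.one_mulVec]
  exact sum_harmProj_mulVec hne hF s (by rw [Pol_eq_top hne hsph hs]; trivial)

/-- If `F_j = q_j(nG)/n` for all `j > l`, then `F_l (q_l(nG)/n) = F_l`. -/
theorem harmProj_mul_zonalMat_predegree (hne : X.Nonempty) (hsph : onSphere m X)
    (hs : (Aset X).card = s) (hF : ∀ i, IsProjOnto X (Harm X i) (F i)) (hq : IsPredegree m X s q)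
    {l : ℕ} (hl : l ≤ s) (h : ∀ j, l < j → j ≤ s → F j = zonalMat X (q j)) :
    F l * zonalMat X (q l) = F l := by
  have h1 : F l * ∑ j ∈ Finset.range (s + 1), zonalMat X (q j) = F l := by
    rw [sum_zonalMat_predegree hne hsph hs hq, mul_one]
  rw [Finset.mul_sum, Finset.sum_eq_single l] at h1
  · exact h1
  · intro j hj hjl
    have hj := Finset.mem_range.1 hj
    rcases lt_or_gt_of_ne hjl with hlt | hgt
    · exact harmProj_mul_zonalMat hne hF (by rw [(hq.1 j (by omega)).1]; exact hlt)
    · rw [← h j hgt (by omega), harmProj_mul hne hF, if_neg (by omega)]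
  · intro h2
    exact absurd (Finset.mem_range.2 (by omega)) h2

/-- One step of the descent: the Gram matrix acts tridiagonally, so `F_j = q_j(nG)/n` for all
`j > l` propagates to `j = l`. -/
theorem harmProj_eq_zonalMat_of_succ (hne : X.Nonempty) (hsph : onSphere m X)
    (hs : (Aset X).card = s) (hF : ∀ i, IsProjOnto X (Harm X i) (F i)) (hq : IsPredegree m X s q)
    (hmul : ∀ (k : ℕ) (b : V) (f : X → ℝ), f ∈ Pol X k →
      (fun x : X => f x * ⟪b, x.1⟫_ℝ) ∈ Pol X (k + 1))
    {l : ℕ} (hl : l + 1 ≤ s) (h : ∀ j, l < j → j ≤ s → F j = zonalMat X (q j)) :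
    F l = zonalMat X (q l) := by
  have hlow : ∀ i, i < l → zonalMat X (q l) * F i = 0 := by
    intro i hi
    have hX : zonalMat X (Polynomial.X * q (l + 1)) * F i = 0 := by
      refine Matrix.ext_of_mulVec_single fun z => ?_
      rw [← Matrix.mulVec_mulVec, Matrix.zero_mulVec]
      set f := (F i).mulVec (Pi.single z 1)
      have hf : f ∈ Pol X i := Harm_le_Pol X i ((hF i).1 _)
      ext y
      have h1 := (hF (l + 1)).2.2 _
        (Pol_le_perp_Harm hne (show i + 1 < l + 1 by omega) (hmul i y f hf))
      rw [h (l + 1) (by omega) hl] at h1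
      have h2 := congrFun h1 y
      simp only [Matrix.mulVec, dotProduct, zonalMat_apply, Polynomial.eval_mul, Polynomial.eval_X]
        at h2 ⊢
      rw [← h2]
      exact Finset.sum_congr rfl fun x _ => by ring
    rw [zonalMat_eq_sum hne hsph hs hq, Finset.sum_mul, Finset.sum_eq_single l] at hX
    · rw [Matrix.smul_mul] at hX
      refine (smul_eq_zero.1 hX).resolve_left (div_ne_zero ?_ ?_)
      · exact trace_X_mul_predegree_succ_ne_zero hne hsph hs hq hl
      · exact predegree_eval_ne_zero hne hsph hs hq (by omega)
    · intro j hj hjl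
      have hj := Finset.mem_range.1 hj
      rw [Matrix.smul_mul]
      rcases lt_or_gt_of_ne hjl with hlt | hgt
      · rw [trace_X_mul_predegree_of_lt hsph hq hl (by omega), zero_div, zero_smul]
      · rw [← h j hgt (by omega), harmProj_mul hne hF, if_neg (by omega), smul_zero]
    · intro h2
      exact absurd (Finset.mem_range.2 (by omega)) h2
  have h1 := congrArg Matrix.transpose
    (harmProj_mul_zonalMat_predegree hne hsph hs hF hq (by omega) h)
  rw [Matrix.transpose_mul, zonalMat_transpose, transpose_eq_of_isProjOnto hne (hF l)] at h1
  have h2 : zonalMat X (q l) * ∑ i ∈ Finset.range (s + 1), F i = zonalMat X (q l) := by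
    rw [sum_harmProj hne hsph hs hF, mul_one]
  rw [Finset.mul_sum, Finset.sum_eq_single l, h1] at h2
  · exact h2
  · intro i _ hil
    rcases lt_or_gt_of_ne hil with hlt | hgt
    · exact hlow i hlt
    · exact zonalMat_mul_harmProj hne hF (by rw [(hq.1 l (by omega)).1]; exact hgt)
  · intro h3
    exact absurd (Finset.mem_range.2 (by omega)) h3

theorem harmProj_eq_zonalMat (hne : X.Nonempty) (hsph : onSphere m X)
    (hs : (Aset X).card = s) (hF : ∀ i, IsProjOnto X (Harm X i) (F i)) (hq : IsPredegree m X s q)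
    (hmul : ∀ (k : ℕ) (b : V) (f : X → ℝ), f ∈ Pol X k →
      (fun x : X => f x * ⟪b, x.1⟫_ℝ) ∈ Pol X (k + 1))
    (h : F s = zonalMat X (q s)) {i : ℕ} (hi : i ≤ s) : F i = zonalMat X (q i) := by
  induction hd : s - i using Nat.strong_induction_on generalizing i with
  | _ d ih =>
    rcases hi.eq_or_lt with rfl | hlt
    · exact h
    · exact harmProj_eq_zonalMat_of_succ hne hsph hs hF hq hmul hlt fun j hj hjs =>
        ih (s - j) (by omega) hjs rfl

theorem trace_sq_harmProj_sub (hne : X.Nonempty) (hsph : onSphere m X)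
    (hs : (Aset X).card = s) (hF : ∀ i, IsProjOnto X (Harm X i) (F i)) (hq : IsPredegree m X s q) :
    Matrix.trace ((F s - zonalMat X (q s)).transpose * (F s - zonalMat X (q s))) =
      (q s).eval m - Matrix.trace (F s) := by
  have h1 := harmProj_mul_zonalMat_predegree hne hsph hs hF hq le_rfl
    fun j hj hjs => absurd hj (by omega)
  have h2 : Matrix.trace (zonalMat X (q s) * zonalMat X (q s)) = (q s).eval m := by
    rw [← pInn_eq_trace hsph, hq.2 s le_rfl s le_rfl, if_pos rfl]
  rw [Matrix.transpose_sub, zonalMat_transpose, transpose_eq_of_isProjOnto hne (hF s), sub_mul,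
    mul_sub, mul_sub, h1, isProjOnto_mul_self (hF s), sub_self, zero_sub, Matrix.trace_neg,
    Matrix.trace_sub, h2, Matrix.trace_mul_comm, h1]
  ring

theorem harmProj_ne_zero (hne : X.Nonempty) (hsph : onSphere m X) (hs : (Aset X).card = s)
    (hdeg : degS X = s) (hF : ∀ i, IsProjOnto X (Harm X i) (F i)) : F s ≠ 0 := by
  intro h0
  have hbot : ∀ f ∈ Harm X s, f = 0 := fun f hf => by
    rw [← (hF s).2.1 f hf, h0, Matrix.zero_mulVec]
  have htop := Pol_eq_top hne hsph hs
  cases s with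
  | zero =>
    obtain ⟨x, hx⟩ := hne
    have h1 := hbot 1 (by change _ ∈ Pol X 0; rw [htop]; trivial)
    exact one_ne_zero (congrFun h1 ⟨x, hx⟩)
  | succ k =>
    have hk : Pol X k = ⊤ := by
      refine eq_top_iff.2 fun f _ => ?_
      obtain ⟨w, hw, u, hu, rfl⟩ := exists_mem_add_perp hne (Pol X k) f
      rw [hbot u ⟨by rw [htop]; trivial, hu⟩, add_zero]
      exact hw
    have : degS X ≤ k := Nat.sInf_le hk
    omega

/-- If `F_s` is a zonal matrix, it is the one of the predegree polynomial. -/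
theorem harmProj_eq_of_zonal (hne : X.Nonempty) (hsph : onSphere m X) (hs : (Aset X).card = s)
    (hdeg : degS X = s) (hF : ∀ i, IsProjOnto X (Harm X i) (F i)) (hq : IsPredegree m X s q)
    {v : Polynomial ℝ} (hv : F s = zonalMat X v) : F s = zonalMat X (q s) := by
  have h1 := harmProj_mul_zonalMat_predegree hne hsph hs hF hq le_rfl
    fun j hj hjs => absurd hj (by omega)
  have h2 := zonalMat_eq_sum hne hsph hs hq v
  rw [Finset.sum_range_succ, Finset.sum_eq_zero, zero_add, ← hv] at h2
  · set c := Matrix.trace (F s * zonalMat X (q s)) / (q s).eval m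
    have h3 : c • F s = F s := by
      calc c • F s = F s * (c • zonalMat X (q s)) := by rw [Matrix.mul_smul, h1]
        _ = F s := by rw [← h2, isProjOnto_mul_self (hF s)]
    have h4 : (c - 1) • F s = 0 := by rw [sub_smul, h3, one_smul, sub_self]
    have h5 : c - 1 = 0 :=
      (smul_eq_zero.1 h4).resolve_right (harmProj_ne_zero hne hsph hs hdeg hF)
    rwa [sub_eq_zero.1 h5, one_smul] at h2
  · intro j hj
    have hj := Finset.mem_range.1 hj
    rw [← hv, harmProj_mul_zonalMat hne hF (by rw [(hq.1 j (by omega)).1]; exact hj)]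
    simp

theorem harmProj_eq_iff_carriesQPolyScheme (hne : X.Nonempty) (hsph : onSphere m X)
    (hdes : IsTwoDesign X) (hs : (Aset X).card = s) (hdeg : degS X = s)
    (hF : ∀ i, IsProjOnto X (Harm X i) (F i)) (hq : IsPredegree m X s q)
    (hmul : ∀ (k : ℕ) (b : V) (f : X → ℝ), f ∈ Pol X k →
      (fun x : X => f x * ⟪b, x.1⟫_ℝ) ∈ Pol X (k + 1)) :
    F s = zonalMat X (q s) ↔ CarriesQPolyScheme m X s F := by
  have hn : (X.card : ℝ) ≠ 0 := by exact_mod_cast hne.card_pos.ne'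
  have hzonal : ∀ v : Polynomial ℝ, (Matrix.of fun x y =>
      (1 / (X.card : ℝ)) * v.eval ((X.card : ℝ) * F 1 x y)) = zonalMat X v := by
    intro v
    ext x y
    rw [Matrix.of_apply, harmProj_one hne hdes hF, zonalMat_apply, zonalMat_apply,
      Polynomial.eval_X]
    congr 2
    field_simp
  constructor
  · intro h
    have hall := fun i hi => harmProj_eq_zonalMat hne hsph hs hF hq hmul h (i := i) hi
    have hprod : ∀ p r : Polynomial ℝ, zonalMat X p * zonalMat X r ∈
        Submodule.span ℝ (relMat X '' (Aset' m X : Set ℝ)) := by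
      intro p r
      rw [zonalMat_eq_sum hne hsph hs hq p, zonalMat_eq_sum hne hsph hs hq r, Finset.sum_mul_sum]
      refine Submodule.sum_mem _ fun i hi => Submodule.sum_mem _ fun j hj => ?_
      have hi : i ≤ s := Nat.lt_succ_iff.1 (Finset.mem_range.1 hi)
      have hj : j ≤ s := Nat.lt_succ_iff.1 (Finset.mem_range.1 hj)
      rw [Matrix.smul_mul, Matrix.mul_smul]
      refine Submodule.smul_mem _ _ (Submodule.smul_mem _ _ ?_)
      rw [← hall i hi, ← hall j hj, harmProj_mul hne hF]
      split_ifs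
      · rw [hall i hi]
        exact zonalMat_mem_span hsph _
      · exact Submodule.zero_mem _
    refine ⟨fun α _ β _ => ?_, fun i hi => ?_, fun i _ j _ => harmProj_mul hne hF i j,
      sum_harmProj hne hsph hs hF, ?_, fun i hi => ⟨q i, (hq.1 i hi).1, ?_⟩⟩
    · obtain ⟨p, -, hp⟩ := exists_zonalMat_eq_relMat hne hsph hs α
      obtain ⟨r, -, hr⟩ := exists_zonalMat_eq_relMat hne hsph hs β
      rw [← hp, ← hr]
      exact hprod p r
    · rw [hall i hi]
      exact zonalMat_mem_span hsph _
    · obtain ⟨c, hc⟩ := Polynomial.natDegree_eq_zero.1 (hq.1 0 (Nat.zero_le s)).1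
      have hF0 := hall 0 (Nat.zero_le s)
      have h1 := (hF 0).2.1 1 (by
        obtain ⟨a, ha⟩ := hne
        exact Submodule.subset_span ⟨a, ha, 1, by simp, by ext; simp⟩)
      obtain ⟨a, ha⟩ := hne
      have h2 := congrFun h1 ⟨a, ha⟩
      rw [hF0, ← hc] at h2
      simp only [Matrix.mulVec, dotProduct, zonalMat_apply, Polynomial.eval_C, Pi.one_apply,
        Finset.sum_const, Finset.card_univ, Fintype.card_coe, nsmul_eq_mul] at h2
      field_simp at h2
      rw [hF0, ← hc, h2]
      ext x y
      simp [zonalMat_apply]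
    · rw [hzonal, hall i hi]
  · rintro ⟨-, -, -, -, -, h⟩
    obtain ⟨v, -, hv⟩ := h s le_rfl
    exact harmProj_eq_of_zonal hne hsph hs hdeg hF hq (hv.trans (hzonal v))

end Excess

theorem statement_13 {m : ℕ} (X : Finset (EuclideanSpace ℝ (Fin m))) (hne : X.Nonempty)
    (hsph : onSphere (m : ℝ) X) (hdes : IsTwoDesign X) (s : ℕ) (hs : (Aset X).card = s)
    (hdeg : degS X = s)
    (F : ℕ → Matrix X X ℝ) (hF : ∀ i, IsProjOnto X (Harm X i) (F i))
    (q : ℕ → Polynomial ℝ) (hq : IsPredegree (m : ℝ) X s q) :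
    Matrix.trace (F s) ≤ (q s).eval (m : ℝ) ∧
    (Matrix.trace (F s) = (q s).eval (m : ℝ) ↔ CarriesQPolyScheme (m : ℝ) X s F) := by
  have h := trace_sq_harmProj_sub hne hsph hs hF hq
  rw [← Matrix.conjTranspose_eq_transpose_of_trivial] at h
  have hnonneg := (Matrix.posSemidef_conjTranspose_mul_self
    (F s - zonalMat X (q s))).trace_nonneg
  refine ⟨by linarith, ?_⟩
  rw [← harmProj_eq_iff_carriesQPolyScheme hne hsph hdes hs hdeg hF hq
    fun k b f hf => mul_inner_mem_Pol hne b hf, ← sub_eq_zero (a := F s),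
    ← Matrix.trace_conjTranspose_mul_self_eq_zero_iff, h, sub_eq_zero, eq_comm]

end
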